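/- arXiv:2309.07008 — 3 statements merged into one kernel-verified Lean document; each statement's English description precedes it below -/
import Mathlib

section
/- Let H : ℝⁿ → ℝ be continuously differentiable and bounded below, let λ > 0, and let x : ℝ → ℝⁿ be a continuously differentiable curve satisfying λ • x'(t) = −∇H(x(t)) for all t ≥ 0. Then there exists an increasing sequence t_k → ∞ such that ∇H(x(t_k)) → 0; moreover, if the trajectory x is bounded, then there exist a point x∞ with ∇H(x∞) = 0 and a sequence s_k → ∞ with x(s_k) → x∞, i.e. the trajectory has a cluster point that is a critical point of H. -/
open MeasureTheory Filter Topology Set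

theorem exists_gt_lt_of_hasDerivAt_neg {f g : ℝ → ℝ} {B T ε : ℝ}
    (hB : ∀ t, B ≤ f t) (hf : ∀ t, T ≤ t → HasDerivAt f (-g t) t) (hε : 0 < ε) :
    ∃ t, T < t ∧ g t < ε := by
  set s : ℝ := (f T - B + 1) / ε with hs
  have hs0 : 0 < s := div_pos (by linarith [hB T]) hε
  obtain ⟨c, hc, hslope⟩ := exists_hasDerivAt_eq_slope f (fun t => -g t)
    (show T < T + s by linarith)
    (fun t ht => (hf t ht.1).continuousAt.continuousWithinAt) (fun t ht => hf t ht.1.le)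
  refine ⟨c, hc.1, ?_⟩
  have hgs : g c * s = f T - f (T + s) := by
    have : -g c * (T + s - T) = f (T + s) - f T := by
      rw [hslope, div_mul_cancel₀ _ (by linarith)]
    linarith
  have hεs : ε * s = f T - B + 1 := by rw [hs]; field_simp
  exact lt_of_mul_lt_mul_right (by linarith [hB (T + s)]) hs0.le

theorem ContDiff.continuous_gradient {E : Type*} [NormedAddCommGroup E] [InnerProductSpace ℝ E]
    [CompleteSpace E] {H : E → ℝ} (hH : ContDiff ℝ 1 H) : Continuous (gradient H) :=
  (InnerProductSpace.toDual ℝ E).symm.continuous.comp (hH.continuous_fderiv one_ne_zero)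

theorem hasDerivAt_comp_of_gradientFlow {E : Type*} [NormedAddCommGroup E]
    [InnerProductSpace ℝ E] [CompleteSpace E] {H : E → ℝ} {x : ℝ → E} {lam t : ℝ}
    (hH : DifferentiableAt ℝ H (x t)) (hx : DifferentiableAt ℝ x t) (hlam : lam ≠ 0)
    (hode : lam • deriv x t = -gradient H (x t)) :
    HasDerivAt (fun s => H (x s)) (-(lam⁻¹ * ‖gradient H (x t)‖ ^ 2)) t := by
  have hderiv : deriv x t = -(lam⁻¹ • gradient H (x t)) := by
    rw [← smul_neg, ← hode, inv_smul_smul₀ hlam]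
  have h := hH.hasGradientAt.hasFDerivAt.comp_hasDerivAt t hx.hasDerivAt
  rw [hderiv, InnerProductSpace.toDual_apply_apply, inner_neg_right, inner_smul_right,
    real_inner_self_eq_norm_sq] at h
  exact h

theorem stmt3 {E : Type*} [NormedAddCommGroup E] [InnerProductSpace ℝ E]
    [FiniteDimensional ℝ E]
    (H : E → ℝ) (hH : ContDiff ℝ 1 H) (hbdd : ∃ B : ℝ, ∀ y, B ≤ H y)
    (lam : ℝ) (hlam : 0 < lam)
    (x : ℝ → E) (hx : ContDiff ℝ 1 x)
    (hode : ∀ t : ℝ, 0 ≤ t → lam • deriv x t = -gradient H (x t)) :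
    (∃ tk : ℕ → ℝ, StrictMono tk ∧ Tendsto tk atTop atTop ∧
      Tendsto (fun k => gradient H (x (tk k))) atTop (𝓝 0)) ∧
    (Bornology.IsBounded (Set.range x) →
      ∃ (xinf : E) (sk : ℕ → ℝ), gradient H xinf = 0 ∧
        Tendsto sk atTop atTop ∧
        Tendsto (fun k => x (sk k)) atTop (𝓝 xinf)) := by
  obtain ⟨B, hB⟩ := hbdd
  have hsmall (n : ℕ) : ∃ t : ℝ, n < t ∧ ‖gradient H (x t)‖ < 1 / ((n : ℝ) + 1) := by
    have hn : (0 : ℝ) < 1 / ((n : ℝ) + 1) := Nat.one_div_pos_of_nat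
    obtain ⟨t, ht, hlt⟩ := exists_gt_lt_of_hasDerivAt_neg (T := n)
      (ε := lam⁻¹ * (1 / ((n : ℝ) + 1)) ^ 2) (fun t => hB (x t))
      (fun t ht => hasDerivAt_comp_of_gradientFlow (hH.differentiable one_ne_zero _)
        (hx.differentiable one_ne_zero t) hlam.ne' (hode t (n.cast_nonneg.trans ht)))
      (by positivity)
    exact ⟨t, ht, lt_of_pow_lt_pow_left₀ 2 hn.le (lt_of_mul_lt_mul_left hlt (by positivity))⟩
  choose u hu hgu using hsmall
  have hu_top : Tendsto u atTop atTop :=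
    tendsto_atTop_mono (fun n => (hu n).le) tendsto_natCast_atTop_atTop
  have hgrad : Tendsto (fun n => gradient H (x (u n))) atTop (𝓝 0) :=
    squeeze_zero_norm (fun n => (hgu n).le) tendsto_one_div_add_atTop_nhds_zero_nat
  constructor
  · obtain ⟨φ, hφ, huφ⟩ := strictMono_subseq_of_tendsto_atTop hu_top
    exact ⟨u ∘ φ, huφ, hu_top.comp hφ.tendsto_atTop, hgrad.comp hφ.tendsto_atTop⟩
  · intro hbounded
    obtain ⟨y, -, φ, hφ, hy⟩ :=
      tendsto_subseq_of_bounded hbounded (fun n => mem_range_self (f := x) (u n))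
    exact ⟨y, u ∘ φ,
      tendsto_nhds_unique ((hH.continuous_gradient.tendsto y).comp hy)
        (hgrad.comp hφ.tendsto_atTop),
      hu_top.comp hφ.tendsto_atTop, hy⟩
end

section
/- Let H : ℝⁿ → ℝ be continuously differentiable, let λ > 0, and let x : ℝ → ℝⁿ be a continuously differentiable curve satisfying λ • x'(t) = −∇H(x(t)) for all t ≥ 0. Let H̄ ∈ ℝ, σ > 0, θ ∈ (1/2,1) and T₀ ≥ 0, and assume that for all t ≥ T₀: H(x(t)) > H̄ and σ(1−θ) · ‖∇H(x(t))‖ ≥ (H(x(t)) − H̄)^{θ}. Then for all t > T₀ one has H(x(t)) − H̄ ≤ ( ((2θ−1)/(σ²(1−θ)²λ)) · (t − T₀) )^{1/(1−2θ)}. -/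
open Filter Topology Set

/-- A positive solution of `h' ≤ -c h ^ p` with `p > 1` decays at least polynomially. -/
theorem le_rpow_of_hasDerivAt_le_neg_rpow {h h' : ℝ → ℝ} {c p a : ℝ} (hc : 0 < c) (hp : 1 < p)
    (hpos : ∀ t, a ≤ t → 0 < h t) (hder : ∀ t, a ≤ t → HasDerivAt h (h' t) t)
    (hle : ∀ t, a ≤ t → h' t ≤ -(c * h t ^ p)) {t : ℝ} (ht : a < t) :
    h t ≤ ((p - 1) * c * (t - a)) ^ (1 / (1 - p)) := by
  have hg : ∀ s, a ≤ s →
      HasDerivAt (fun r => h r ^ (1 - p)) (h' s * (1 - p) * h s ^ (1 - p - 1)) s :=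
    fun s hs => (hder s hs).rpow_const (Or.inl (hpos s hs).ne')
  have hslope : (p - 1) * c * (t - a) ≤ h t ^ (1 - p) - h a ^ (1 - p) := by
    refine (convex_Ici a).mul_sub_le_image_sub_of_le_deriv
      (fun s hs => (hg s hs).continuousAt.continuousWithinAt)
      (fun s hs => (hg s (interior_subset hs)).differentiableAt.differentiableWithinAt)
      (fun s hs => ?_) a self_mem_Ici t ht.le ht.le
    have hs : a ≤ s := interior_subset hs
    have hone : h s ^ p * h s ^ (1 - p - 1) = 1 := by
      rw [← Real.rpow_add (hpos s hs), show p + (1 - p - 1) = 0 by ring, Real.rpow_zero]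
    rw [(hg s hs).deriv]
    calc (p - 1) * c = (p - 1) * (c * h s ^ p) * h s ^ (1 - p - 1) := by
          linear_combination -((p - 1) * c) * hone
      _ ≤ (p - 1) * -h' s * h s ^ (1 - p - 1) := by
          have := Real.rpow_nonneg (hpos s hs).le (1 - p - 1)
          have := hle s hs
          gcongr
          linarith
      _ = h' s * (1 - p) * h s ^ (1 - p - 1) := by ring
  have hbase : 0 < (p - 1) * c * (t - a) :=
    mul_pos (mul_pos (sub_pos.2 hp) hc) (sub_pos.2 ht)
  calc h t = (h t ^ (1 - p)) ^ (1 / (1 - p)) := by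
        rw [← Real.rpow_mul (hpos t ht.le).le, mul_one_div_cancel (by linarith), Real.rpow_one]
    _ ≤ ((p - 1) * c * (t - a)) ^ (1 / (1 - p)) :=
        Real.rpow_le_rpow_of_nonpos hbase
          (by linarith [Real.rpow_nonneg (hpos a le_rfl).le (1 - p)])
          (one_div_nonpos.2 (by linarith))

/-- The energy dissipation identity along a rescaled gradient flow. -/
theorem hasDerivAt_comp_of_smul_deriv_eq_neg_gradient {E : Type*} [NormedAddCommGroup E]
    [InnerProductSpace ℝ E] [CompleteSpace E] {H : E → ℝ} {x : ℝ → E} {lam t : ℝ}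
    (hlam : lam ≠ 0) (hH : DifferentiableAt ℝ H (x t)) (hx : DifferentiableAt ℝ x t)
    (hode : lam • deriv x t = -gradient H (x t)) :
    HasDerivAt (fun s => H (x s)) (-(‖gradient H (x t)‖ ^ 2 / lam)) t := by
  have hd := hH.hasGradientAt.hasFDerivAt.comp_hasDerivAt t hx.hasDerivAt
  have hx' : deriv x t = lam⁻¹ • -gradient H (x t) := by rw [← hode, inv_smul_smul₀ hlam]
  refine hd.congr_deriv ?_
  rw [hx', InnerProductSpace.toDual_apply_apply, inner_smul_right, inner_neg_right,
    real_inner_self_eq_norm_sq]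
  ring

theorem stmt7 {E : Type*} [NormedAddCommGroup E] [InnerProductSpace ℝ E]
    [FiniteDimensional ℝ E]
    (H : E → ℝ) (hH : ContDiff ℝ 1 H) (lam : ℝ) (hlam : 0 < lam)
    (x : ℝ → E) (hx : ContDiff ℝ 1 x)
    (hode : ∀ t : ℝ, 0 ≤ t → lam • deriv x t = -gradient H (x t))
    (Hbar σ θ T₀ : ℝ) (hσ : 0 < σ) (hθ : θ ∈ Set.Ioo (1 / 2 : ℝ) 1) (hT₀ : 0 ≤ T₀)
    (hpos : ∀ t, T₀ ≤ t → Hbar < H (x t))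
    (hKL : ∀ t, T₀ ≤ t →
      (H (x t) - Hbar) ^ θ ≤ σ * (1 - θ) * ‖gradient H (x t)‖) :
    ∀ t, T₀ < t →
      H (x t) - Hbar ≤
        ((2 * θ - 1) / (σ ^ 2 * (1 - θ) ^ 2 * lam) * (t - T₀)) ^ ((1 : ℝ) / (1 - 2 * θ)) := by
  intro t ht
  obtain ⟨hθ₁, hθ₂⟩ := hθ
  have hθ' : 0 < 1 - θ := sub_pos.2 hθ₂
  have hK : 0 < σ ^ 2 * (1 - θ) ^ 2 * lam := by positivity
  have key := le_rpow_of_hasDerivAt_le_neg_rpow (h := fun s => H (x s) - Hbar)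
    (h' := fun s => -(‖gradient H (x s)‖ ^ 2 / lam)) (p := 2 * θ) (inv_pos.2 hK)
    (by linarith) (fun s hs => sub_pos.2 (hpos s hs))
    (fun s hs => (hasDerivAt_comp_of_smul_deriv_eq_neg_gradient hlam.ne'
      (hH.differentiable one_ne_zero _) (hx.differentiable one_ne_zero _)
      (hode s (hT₀.trans hs))).sub_const Hbar)
    (fun s hs => ?_) ht
  · simpa only [div_eq_mul_inv] using key
  · have hnn : 0 ≤ H (x s) - Hbar := (sub_pos.2 (hpos s hs)).le
    have hsq := pow_le_pow_left₀ (Real.rpow_nonneg hnn θ) (hKL s hs) 2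
    rw [← Real.rpow_mul_natCast hnn, Nat.cast_ofNat, mul_comm θ 2] at hsq
    rw [neg_le_neg_iff, inv_mul_le_iff₀ hK]
    calc (H (x s) - Hbar) ^ (2 * θ) ≤ _ := hsq
      _ = σ ^ 2 * (1 - θ) ^ 2 * lam * (‖gradient H (x s)‖ ^ 2 / lam) := by
        field_simp
end

section
/- Let H : ℝⁿ → ℝ be differentiable with L-Lipschitz gradient (L > 0) and bounded below, let λ, γ, α > 0, and let c satisfy 0 < c < min{2λ/L, (√(L² + 2λγL) − L)/L}; set a := λγ − cL − c²L/2 and b := cλ − c²L/2. Let x : (0,∞) → ℝⁿ be twice continuously differentiable and satisfy λ x''(t) + λ(γ + α/t) x'(t) + ∇H(x(t)) = 0 for all t > 0, and define V(t) := H(x(t) + c • x'(t)) + (λ/2)(1 + cγ + cα/t) ‖x'(t)‖². Assume there exist V̄ ∈ ℝ, T₀ > 0, θ ∈ (0,1), σ > 0 and C₁, C₂ > 0 such that for all t ≥ T₀: V(t) > V̄ and (V(t) − V̄)^{θ} ≤ σ(1−θ) (C₁ ‖x'(t)‖ + C₂ ‖x''(t)‖). Then ∫_{T₀}^{∞} ‖x'(t)‖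 dt < ∞ and ∫_{T₀}^{∞} ‖x''(t)‖ dt < ∞, the trajectory x(t) converges to a limit x∞ as t → ∞, and ∇H(x∞) = 0. -/
open MeasureTheory Filter Topology Set

/-- A nonnegative function dominated by the derivative of a function that is bounded above
is integrable at infinity. -/
theorem integrableOn_Ioi_of_le_deriv {φ g g' : ℝ → ℝ} {T B : ℝ}
    (hφ : ContinuousOn φ (Ici T)) (hφ0 : ∀ t, T ≤ t → 0 ≤ φ t)
    (hg : ∀ t, T ≤ t → HasDerivAt g (g' t) t) (hle : ∀ t, T ≤ t → φ t ≤ g' t)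
    (hB : ∀ t, T ≤ t → g t ≤ B) : IntegrableOn φ (Ioi T) := by
  have hint : ∀ r, IntegrableOn φ (Icc T r) := fun r =>
    (hφ.mono Icc_subset_Ici_self).integrableOn_compact isCompact_Icc
  refine integrableOn_Ioi_of_intervalIntegral_norm_bounded (l := atTop) (b := id) (B - g T) T
    (fun r => (hint r).mono_set Ioc_subset_Icc_self) tendsto_id ?_
  filter_upwards [eventually_ge_atTop T] with r hr
  have hnorm : ∫ t in T..r, ‖φ t‖ = ∫ t in T..r, φ t := by
    refine intervalIntegral.integral_congr fun t ht => ?_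
    rw [uIcc_of_le hr] at ht
    exact Real.norm_of_nonneg (hφ0 t ht.1)
  have hsub : ∫ t in T..r, φ t ≤ g r - g T :=
    intervalIntegral.integral_le_sub_of_hasDeriv_right_of_le hr
      (fun t ht => (hg t ht.1).continuousAt.continuousWithinAt)
      (fun t ht => (hg t ht.1.le).hasDerivWithinAt) (hint r) (fun t ht => hle t ht.1.le)
  rw [id, hnorm]
  linarith [hB r hr]

/-- A continuous function that is integrable at infinity and has a limit there tends to zero. -/
theorem eq_zero_of_tendsto_of_integrableOn_norm {F : Type*} [NormedAddCommGroup F]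
    {f : ℝ → F} {T : ℝ} {l : F} (hint : IntegrableOn (fun t => ‖f t‖) (Ioi T))
    (hl : Tendsto f atTop (𝓝 l)) : l = 0 := by
  refine norm_eq_zero.1 (IntegrableAtFilter.eq_zero_of_tendsto (μ := volume)
    ⟨Ioi T, Ioi_mem_atTop T, hint⟩ (fun s hs => ?_) hl.norm)
  obtain ⟨r, hr⟩ := mem_atTop_sets.1 hs
  exact top_le_iff.1 (Real.volume_Ici (a := r) ▸ measure_mono fun t ht => hr t ht)

/-- The dissipation estimate: `v` and `w` are the velocity and the acceleration, `g` and `G` the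
gradients at `x` and at `x + c • v`. -/
theorem lyapunov_deriv_le {E : Type*} [NormedAddCommGroup E] [InnerProductSpace ℝ E]
    {lam γ δ c L ε : ℝ} {v w g G : E} (hlam : 0 ≤ lam) (hδ : 0 ≤ δ) (hε : 0 ≤ ε)
    (hc : 0 ≤ c) (hL : 0 ≤ L)
    (hode : lam • w + (lam * (γ + δ)) • v + g = 0) (hG : ‖G - g‖ ≤ L * (c * ‖v‖)) :
    inner ℝ G (v + c • w) + (lam / 2 * (-ε) * ‖v‖ ^ 2
        + lam / 2 * (1 + c * γ + c * δ) * (2 * inner ℝ v w))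
      ≤ -((lam * γ - c * L - c ^ 2 * L / 2) * ‖v‖ ^ 2
          + (c * lam - c ^ 2 * L / 2) * ‖w‖ ^ 2) := by
  have hg : g = -(lam • w + (lam * (γ + δ)) • v) := (neg_eq_of_add_eq_zero_right hode).symm
  have hsplit : inner ℝ G (v + c • w) = inner ℝ (G - g) (v + c • w) + inner ℝ g (v + c • w) := by
    rw [← inner_add_left, sub_add_cancel]
  have hinner : inner ℝ g (v + c • w) = -(lam * inner ℝ v w + lam * (γ + δ) * ‖v‖ ^ 2
      + c * lam * ‖w‖ ^ 2 + c * lam * (γ + δ) * inner ℝ v w) := by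
    rw [hg, inner_neg_left, inner_add_left, inner_add_right, inner_add_right]
    simp only [real_inner_smul_left, real_inner_smul_right, real_inner_self_eq_norm_sq,
      real_inner_comm v w]
    ring
  have hcs : inner ℝ (G - g) (v + c • w) ≤ L * (c * ‖v‖) * (‖v‖ + c * ‖w‖) := by
    refine (real_inner_le_norm _ _).trans (mul_le_mul hG ?_ (norm_nonneg _) (by positivity))
    exact (norm_add_le _ _).trans_eq (by rw [norm_smul, Real.norm_of_nonneg hc])
  have hyoung : 0 ≤ c ^ 2 * L / 2 * (‖v‖ - ‖w‖) ^ 2 := by positivity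
  have hδv : 0 ≤ lam * δ * ‖v‖ ^ 2 := by positivity
  have hεv : 0 ≤ lam / 2 * ε * ‖v‖ ^ 2 := by positivity
  rw [hsplit, hinner]
  nlinarith

/-- The desingularized energy `W ^ (1 - θ)` decreases at least at the rate `κ * (p + q)`. -/
theorem kl_rate_le {W θ K m p q a b D : ℝ} (hW : 0 < W) (hθ : θ < 1) (hK : 0 < K)
    (hp : 0 ≤ p) (hq : 0 ≤ q) (hm : 0 ≤ m) (hma : m ≤ a) (hmb : m ≤ b)
    (hKL : W ^ θ ≤ K * (p + q)) (hD : D ≤ -(a * p ^ 2 + b * q ^ 2)) :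
    (1 - θ) * m / (2 * K) * (p + q) ≤ -(D * (1 - θ) * W ^ (1 - θ - 1)) := by
  have hWθ : 0 < W ^ θ := Real.rpow_pos_of_pos hW θ
  have hpow : W ^ (1 - θ - 1) = (W ^ θ)⁻¹ := by
    rw [← Real.rpow_neg hW.le]; congr 1; ring
  have hquad : m / 2 * (p + q) ^ 2 ≤ -D := by
    nlinarith [mul_nonneg hm (sq_nonneg (p - q)), mul_le_mul_of_nonneg_right hma (sq_nonneg p),
      mul_le_mul_of_nonneg_right hmb (sq_nonneg q)]
  have hθ' : 0 < 1 - θ := sub_pos.2 hθ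
  have hfactor : 0 ≤ m / (2 * K) * (p + q) := by positivity
  have hmain : m / (2 * K) * (p + q) * W ^ θ ≤ -D := by
    refine (mul_le_mul_of_nonneg_left hKL hfactor).trans (le_of_eq_of_le ?_ hquad)
    field_simp
  rw [hpow, show -(D * (1 - θ) * (W ^ θ)⁻¹) = (1 - θ) * (-D / W ^ θ) by ring, mul_div_assoc,
    mul_assoc]
  exact mul_le_mul_of_nonneg_left ((le_div_iff₀ hWθ).2 hmain) hθ'.le

theorem stmt16 {E : Type*} [NormedAddCommGroup E] [InnerProductSpace ℝ E]
    [FiniteDimensional ℝ E]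
    (H : E → ℝ) (hH : Differentiable ℝ H) (L : ℝ) (hL : 0 < L)
    (hLip : ∀ u v : E, ‖gradient H u - gradient H v‖ ≤ L * ‖u - v‖)
    (hbdd : ∃ B : ℝ, ∀ y, B ≤ H y)
    (lam γ α c : ℝ) (hlam : 0 < lam) (hγ : 0 < γ) (hα : 0 < α)
    (hc0 : 0 < c)
    (hc1 : c < min (2 * lam / L) ((Real.sqrt (L ^ 2 + 2 * lam * γ * L) - L) / L))
    (a b : ℝ) (ha : a = lam * γ - c * L - c ^ 2 * L / 2)
    (hb : b = c * lam - c ^ 2 * L / 2)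
    (x : ℝ → E) (hx : ContDiffOn ℝ 2 x (Set.Ioi 0))
    (hode : ∀ t : ℝ, 0 < t →
      lam • deriv (deriv x) t + (lam * (γ + α / t)) • deriv x t
        + gradient H (x t) = 0)
    (V : ℝ → ℝ)
    (hV : ∀ t : ℝ, V t = H (x t + c • deriv x t)
        + lam / 2 * (1 + c * γ + c * α / t) * ‖deriv x t‖ ^ 2)
    (Vbar T₀ θ σ C₁ C₂ : ℝ) (hT₀ : 0 < T₀) (hθ : θ ∈ Set.Ioo (0 : ℝ) 1)
    (hσ : 0 < σ) (hC₁ : 0 < C₁) (hC₂ : 0 < C₂)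
    (hVpos : ∀ t, T₀ ≤ t → Vbar < V t)
    (hKL : ∀ t, T₀ ≤ t →
      (V t - Vbar) ^ θ ≤
        σ * (1 - θ) * (C₁ * ‖deriv x t‖ + C₂ * ‖deriv (deriv x) t‖)) :
    IntegrableOn (fun t => ‖deriv x t‖) (Set.Ici T₀) ∧
    IntegrableOn (fun t => ‖deriv (deriv x) t‖) (Set.Ici T₀) ∧
    ∃ xinf : E, Tendsto x atTop (𝓝 xinf) ∧ gradient H xinf = 0 := by
  obtain ⟨hcb, hca⟩ := lt_min_iff.1 hc1
  have hb0 : 0 < b := by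
    rw [lt_div_iff₀ hL] at hcb
    rw [hb]
    nlinarith
  have ha0 : 0 < a := by
    rw [lt_div_iff₀ hL, lt_sub_iff_add_lt, Real.lt_sqrt (by positivity)] at hca
    have h : L * (2 * (c * L + c ^ 2 * L / 2)) < L * (2 * (lam * γ)) := by linarith
    rw [ha]
    linarith [lt_of_mul_lt_mul_left h hL.le]
  have hx₁ : ∀ t, 0 < t → HasDerivAt x (deriv x t) t := fun t ht =>
    ((hx.differentiableOn (by norm_num)).differentiableAt (Ioi_mem_nhds ht)).hasDerivAt
  have hdx : ContDiffOn ℝ 1 (deriv x) (Ioi 0) :=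
    ((contDiffOn_succ_iff_deriv_of_isOpen (n := 1) isOpen_Ioi).1
      (by rwa [one_add_one_eq_two])).2.2
  have hx₂ : ∀ t, 0 < t → HasDerivAt (deriv x) (deriv (deriv x) t) t := fun t ht =>
    ((hdx.differentiableOn one_ne_zero).differentiableAt (Ioi_mem_nhds ht)).hasDerivAt
  have hsub : Ici T₀ ⊆ Ioi (0 : ℝ) := fun t ht => hT₀.trans_le ht
  have hc₁ : ContinuousOn (deriv x) (Ici T₀) := hdx.continuousOn.mono hsub
  have hc₂ : ContinuousOn (deriv (deriv x)) (Ici T₀) :=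
    (hdx.continuousOn_deriv_of_isOpen isOpen_Ioi le_rfl).mono hsub
  have hVderiv : ∀ t, T₀ ≤ t → ∃ D, HasDerivAt V D t ∧
      D ≤ -(a * ‖deriv x t‖ ^ 2 + b * ‖deriv (deriv x) t‖ ^ 2) := by
    intro t ht
    have ht0 : 0 < t := hT₀.trans_le ht
    have hH' := (hH (x t + c • deriv x t)).hasGradientAt.hasFDerivAt.comp_hasDerivAt t
      ((hx₁ t ht0).add ((hx₂ t ht0).const_smul c))
    have hcoef : HasDerivAt (fun s : ℝ => lam / 2 * (1 + c * γ + c * α / s))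
        (lam / 2 * (-(c * α / t ^ 2))) t := by
      exact ((((hasDerivAt_inv ht0.ne').const_mul (c * α)).const_add (1 + c * γ)).const_mul
        (lam / 2)).congr_deriv (by ring)
    have hV' := hH'.add (hcoef.mul (hx₂ t ht0).norm_sq)
    refine ⟨_, hV'.congr_of_eventuallyEq (Eventually.of_forall hV), ?_⟩
    have hest := lyapunov_deriv_le (ε := c * α / t ^ 2) hlam.le (by positivity : 0 ≤ α / t)
      (by positivity) hc0.le hL.le (hode t ht0)
      (G := gradient H (x t + c • deriv x t))
      ((hLip _ _).trans_eq (by rw [add_sub_cancel_left, norm_smul, Real.norm_of_nonneg hc0.le]))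
    rw [ha, hb]
    refine le_of_eq_of_le ?_ hest
    rw [InnerProductSpace.toDual_apply_apply, mul_div_assoc c α t]
  choose! V' hV' hV'le using hVderiv
  have hθ1 : 0 < 1 - θ := sub_pos.2 hθ.2
  set K := σ * (1 - θ) * (C₁ + C₂) with hK
  have hK0 : 0 < K := by positivity
  set κ := (1 - θ) * min a b / (2 * K) with hκ
  have hm : 0 < min a b := lt_min ha0 hb0
  have hκ0 : 0 < κ := by positivity
  have hφint : IntegrableOn
      (fun t => κ * (‖deriv x t‖ + ‖deriv (deriv x) t‖)) (Ioi T₀) := by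
    refine integrableOn_Ioi_of_le_deriv (g := fun t => -(V t - Vbar) ^ (1 - θ))
      (g' := fun t => -(V' t * (1 - θ) * (V t - Vbar) ^ (1 - θ - 1))) (B := 0)
      (continuousOn_const.mul (hc₁.norm.add hc₂.norm)) (fun t _ => by positivity)
      (fun t ht => (((hV' t ht).sub_const Vbar).rpow_const
        (Or.inl (sub_pos.2 (hVpos t ht)).ne')).neg) (fun t ht => ?_)
      (fun t ht => neg_nonpos.2 (Real.rpow_nonneg (sub_pos.2 (hVpos t ht)).le _))
    refine kl_rate_le (sub_pos.2 (hVpos t ht)) hθ.2 hK0 (norm_nonneg _) (norm_nonneg _) hm.le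
      (min_le_left _ _) (min_le_right _ _) ((hKL t ht).trans ?_) (hV'le t ht)
    rw [hK, mul_assoc _ (C₁ + C₂)]
    refine mul_le_mul_of_nonneg_left ?_ (by positivity)
    nlinarith [mul_nonneg hC₁.le (norm_nonneg (deriv (deriv x) t)),
      mul_nonneg hC₂.le (norm_nonneg (deriv x t))]
  have hsum : IntegrableOn (fun t => ‖deriv x t‖ + ‖deriv (deriv x) t‖) (Ioi T₀) := by
    refine (hφint.const_mul κ⁻¹).congr (Eventually.of_forall fun t => ?_)
    exact inv_mul_cancel_left₀ hκ0.ne' _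
  have hm₁ := (hc₁.mono Ioi_subset_Ici_self).aestronglyMeasurable
    (μ := volume) measurableSet_Ioi
  have hm₂ := (hc₂.mono Ioi_subset_Ici_self).aestronglyMeasurable
    (μ := volume) measurableSet_Ioi
  have hi₁ : IntegrableOn (deriv x) (Ioi T₀) := hsum.mono' hm₁
    (Eventually.of_forall fun t => le_add_of_nonneg_right (norm_nonneg _))
  have hi₂ : IntegrableOn (deriv (deriv x)) (Ioi T₀) := hsum.mono' hm₂
    (Eventually.of_forall fun t => le_add_of_nonneg_left (norm_nonneg _))
  refine ⟨(integrableOn_Ici_iff_integrableOn_Ioi).2 hi₁.norm,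
    (integrableOn_Ici_iff_integrableOn_Ioi).2 hi₂.norm, limUnder atTop x, ?_⟩
  have hlim : Tendsto x atTop (𝓝 (limUnder atTop x)) :=
    tendsto_limUnder_of_hasDerivAt_of_integrableOn_Ioi (fun t ht => hx₁ t (hT₀.trans ht)) hi₁
  refine ⟨hlim, ?_⟩
  have hlim₁ : Tendsto (deriv x) atTop (𝓝 0) := by
    have h := tendsto_limUnder_of_hasDerivAt_of_integrableOn_Ioi
      (fun t ht => hx₂ t (hT₀.trans ht)) hi₂
    rwa [eq_zero_of_tendsto_of_integrableOn_norm hi₁.norm h] at h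
  have hgrad : Continuous (gradient H) :=
    (LipschitzWith.of_dist_le_mul (K := ⟨L, hL.le⟩) fun u v => by
      rw [dist_eq_norm, dist_eq_norm]
      exact hLip u v).continuous
  have hcoef : Tendsto (fun t : ℝ => lam * (γ + α / t)) atTop (𝓝 (lam * (γ + 0))) :=
    ((tendsto_const_nhds.div_atTop tendsto_id).const_add γ).const_mul lam
  have hlim₂ : Tendsto (fun t => lam • deriv (deriv x) t) atTop
      (𝓝 (-((lam * (γ + 0)) • (0 : E) + gradient H (limUnder atTop x)))) := by
    refine ((hcoef.smul hlim₁).add ((hgrad.tendsto _).comp hlim)).neg.congr' ?_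
    filter_upwards [eventually_gt_atTop 0] with t ht
    exact neg_eq_of_add_eq_zero_left (by rw [← hode t ht, Function.comp_apply, add_assoc])
  have hzero := eq_zero_of_tendsto_of_integrableOn_norm (hi₂.smul lam).norm hlim₂
  simpa using hzero
end
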